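/- Let B(F) be a stationary generalized Bratteli diagram and A = F^T. Suppose A is irreducible, aperiodic and positive recurrent with finite Perron eigenvalue λ, and let ξ = (ξ_v) and η = (η_v) be the right and left Perron eigenvectors of A normalized so that ∑_{v∈V_0} ξ_v = 1 and ∑_{v∈V_0} η_v ξ_v = 1. Then for all v, w ∈ V_0, the ratio of tower heights H^{(n)}_w / H^{(n+1)}_v converges to η_w / (λ · η_v) as n → ∞, where H^{(n)}_u = ∑_{u_0∈V_0} a^{(n)}_{u_0,u} is the number of finite paths from level V_0 to the vertex u at level V_n. -/

import Mathlib

open scoped ENNReal NNReal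
open Filter
open scoped Classical

noncomputable section

/-- Powers of a countably infinite nonnegative matrix, computed in `ℝ≥0∞`:
`matPow A n i j` is the `(i, j)` entry of `A ^ n`. -/
noncomputable def matPow {ι : Type} (A : ι → ι → ℝ≥0∞) : ℕ → ι → ι → ℝ≥0∞
  | 0 => fun i j => if i = j then 1 else 0
  | n + 1 => fun i j => ∑' k : ι, matPow A n i k * A k j

/-- `A` is irreducible: for every pair of indices `i, j` there is `n ≥ 1` with
`(A ^ n)_{i j} > 0`. -/
def MatIrreducible {ι : Type} (A : ι → ι → ℝ≥0∞) : Prop :=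
  ∀ i j : ι, ∃ n : ℕ, 0 < n ∧ matPow A n i j ≠ 0

/-- `A` is aperiodic: for every index `i`, the gcd of `{n ≥ 1 : (A ^ n)_{i i} > 0}`
is `1`, i.e. the only common divisor of that set is `1`. -/
def MatAperiodic {ι : Type} (A : ι → ι → ℝ≥0∞) : Prop :=
  ∀ i : ι, ∀ d : ℕ, (∀ n : ℕ, 0 < n → matPow A n i i ≠ 0 → d ∣ n) → d = 1

/-- `lam` is the Perron eigenvalue of `A`: `lam = lim_n ((A ^ n)_{i i})^{1/n}`
(independently of `i`). -/
def IsPerronValue {ι : Type} (A : ι → ι → ℝ≥0∞) (lam : ℝ≥0∞) : Prop :=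
  ∀ i : ι, Tendsto (fun n : ℕ => matPow A n i i ^ ((n : ℝ)⁻¹)) atTop (nhds lam)

/-- `A` (with Perron value `lam`) is recurrent: `∑_n (A ^ n)_{i i} / lam ^ n = ∞`. -/
def MatRecurrent {ι : Type} (A : ι → ι → ℝ≥0∞) (lam : ℝ≥0∞) : Prop :=
  ∀ i : ι, ∑' n : ℕ, matPow A n i i * (lam⁻¹) ^ n = ⊤

/-- The first-return counts: `lcount A n w v` is the quantity `l_{w v}(n)` defined by
`l_{w v}(1) = a_{w v}` and `l_{w v}(n+1) = ∑_{i ≠ w} l_{w i}(n) a_{i v}`. -/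
noncomputable def lcount {ι : Type} (A : ι → ι → ℝ≥0∞) : ℕ → ι → ι → ℝ≥0∞
  | 0 => fun _ _ => 0
  | 1 => A
  | n + 2 => fun w v => ∑' i : ι, if i = w then 0 else lcount A (n + 1) w i * A i v

/-- `A` (with Perron value `lam`) is positive recurrent: it is recurrent and
`∑_n n · l_{w w}(n) · lam ^ {-n} < ∞`. -/
def MatPosRecurrent {ι : Type} (A : ι → ι → ℝ≥0∞) (lam : ℝ≥0∞) : Prop :=
  MatRecurrent A lam ∧
    ∀ w : ι, ∑' n : ℕ, (n : ℝ≥0∞) * lcount A n w w * (lam⁻¹) ^ n ≠ ⊤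

end

open Set MeasureTheory

/-- A stationary generalized Bratteli diagram with vertex levels identified with `ℤ`:
the same countable edge set `E` (with source and range maps `s, r : E → ℤ`) connects
every pair of consecutive levels. -/
structure StatGBD where
  /-- the set of edges between any two consecutive levels -/
  E : Type
  countE : Countable E
  src : E → ℤ
  rng : E → ℤ
  src_surj : ∀ v : ℤ, ∃ e : E, src e = v
  rng_surj : ∀ v : ℤ, ∃ e : E, rng e = v
  rng_fin : ∀ v : ℤ, {e : E | rng e = v}.Finite

namespace StatGBD

variable (B : StatGBD)

/-- The path space `X_B`: infinite sequences of composable edges. -/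
def Path := { x : ℕ → B.E // ∀ n, B.src (x (n + 1)) = B.rng (x n) }

/-- The topology on the path space, generated by cylinder sets: the topology induced
from the product of the discrete topologies on the edge set. -/
instance : TopologicalSpace B.Path :=
  TopologicalSpace.induced (fun x : B.Path => x.1)
    (@Pi.topologicalSpace ℕ (fun _ => B.E) (fun _ => ⊥))

/-- The Borel σ-algebra on the path space. -/
instance : MeasurableSpace B.Path := borel B.Path

/-- A finite path from level `0` to level `n + 1` (a sequence of `n + 1` composable
edges). -/
def FinPath (n : ℕ) :=
  { p : Fin (n + 1) → B.E // ∀ i : Fin n, B.src (p i.succ) = B.rng (p i.castSucc) }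

/-- The range of a finite path: a vertex of level `n + 1`. -/
def FinPath.out {n : ℕ} (p : B.FinPath n) : ℤ := B.rng (p.1 (Fin.last n))

/-- The cylinder set of a finite path. -/
def cyl {n : ℕ} (p : B.FinPath n) : Set B.Path :=
  { x : B.Path | ∀ i : Fin (n + 1), x.1 i.1 = p.1 i }

/-- Two infinite paths are tail equivalent if they eventually agree. -/
def TailEquiv (x y : B.Path) : Prop := ∃ N : ℕ, ∀ n, N ≤ n → x.1 n = y.1 n

/-- The incidence matrix of the stationary diagram: `Fmat B v w` is the number of edges
from the vertex `w` of one level to the vertex `v` of the next level (i.e. `f_{v w}`),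
viewed in `ℝ≥0∞`. -/
noncomputable def Fmat : ℤ → ℤ → ℝ≥0∞ :=
  fun v w => (Nat.card {e : B.E // B.src e = w ∧ B.rng e = v} : ℝ≥0∞)

/-- The transpose `A = Fᵀ` of the incidence matrix: `Amat B w v = a_{w v} = f_{v w}`
is the number of edges from `w` to `v`, viewed in `ℝ≥0∞`. -/
noncomputable def Amat : ℤ → ℤ → ℝ≥0∞ :=
  fun w v => (Nat.card {e : B.E // B.src e = w ∧ B.rng e = v} : ℝ≥0∞)

end StatGBD

open scoped Topology

theorem hr_summable_aux {ι : Type} {p h : ι → ℝ} (hp0 : ∀ x, 0 ≤ p x) (hp : Summable p)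
    (h0 : ∀ x, 0 ≤ h x) (h1 : ∀ x, h x ≤ 1) : Summable fun x => p x * h x :=
  Summable.of_nonneg_of_le (fun x => mul_nonneg (hp0 x) (h0 x))
    (fun x => mul_le_of_le_one_right (hp0 x) (h1 x)) hp

theorem hr_le_one_aux {ι : Type} {p h : ι → ℝ} (hp0 : ∀ x, 0 ≤ p x) (hp : HasSum p 1)
    (h0 : ∀ x, 0 ≤ h x) (h1 : ∀ x, h x ≤ 1) : ∑' x, p x * h x ≤ 1 := by
  rw [← hp.tsum_eq]
  exact (hr_summable_aux hp0 hp.summable h0 h1).tsum_le_tsum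
    (fun x => mul_le_of_le_one_right (hp0 x) (h1 x)) hp.summable

theorem hr_stat {ι : Type} {P : ι → ι → ℝ} {p : ι → ℝ} (hP0 : ∀ x y, 0 ≤ P x y)
    (hP : ∀ x, HasSum (P x) 1) (hp0 : ∀ x, 0 < p x) (hp : HasSum p 1)
    (hst : ∀ y, HasSum (fun x => p x * P x y) (p y)) {h : ι → ℝ}
    (h0 : ∀ x, 0 ≤ h x) (h1 : ∀ x, h x ≤ 1) :
    ∑' x, p x * ∑' y, P x y * h y = ∑' y, p y * h y := by
  have hs : Summable (fun q : ι × ι => p q.1 * (P q.1 q.2 * h q.2)) := by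
    have hnn : ∀ q : ι × ι, (0 : ℝ) ≤ p q.1 * (P q.1 q.2 * h q.2) := by
      intro q
      have a1 := (hp0 q.1).le
      have a2 := hP0 q.1 q.2
      have a3 := h0 q.2
      positivity
    refine (summable_prod_of_nonneg (f := fun q : ι × ι => p q.1 * (P q.1 q.2 * h q.2))
      hnn).2 ⟨fun x => ?_, ?_⟩
    · exact Summable.mul_left (p x) (hr_summable_aux (hP0 x) (hP x).summable h0 h1)
    simp only [tsum_mul_left]
    exact hr_summable_aux (fun x => (hp0 x).le) hp.summable
      (fun x => tsum_nonneg fun y => mul_nonneg (hP0 _ _) (h0 _))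
      (fun x => hr_le_one_aux (hP0 x) (hP x) h0 h1)
  have := Summable.tsum_comm (f := fun x y => p x * (P x y * h y)) hs
  simp only [tsum_mul_left] at this
  rw [← this]
  refine tsum_congr fun y => ?_
  rw [← (hst y).tsum_eq, ← tsum_mul_right]
  simp only [mul_assoc]

theorem hr_var {ι : Type} {q h : ι → ℝ} (hq0 : ∀ x, 0 ≤ q x) (hq : HasSum q 1)
    (h0 : ∀ x, 0 ≤ h x) (h1 : ∀ x, h x ≤ 1) :
    HasSum (fun y => q y * (h y - ∑' z, q z * h z) ^ 2)
      (∑' y, q y * h y ^ 2 - (∑' y, q y * h y) ^ 2) := by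
  have a1 := (hr_summable_aux hq0 hq.summable h0 h1).hasSum
  have a2 := (hr_summable_aux hq0 hq.summable (fun x => sq_nonneg (h x))
    (fun x => pow_le_one₀ (h0 x) (h1 x))).hasSum
  set m := ∑' z, q z * h z
  have := (a2.sub (a1.mul_left (2 * m))).add (hq.mul_left (m ^ 2))
  have e1 : (fun y => q y * (h y - m) ^ 2)
      = fun b => q b * h b ^ 2 - 2 * m * (q b * h b) + m ^ 2 * q b := by
    funext y; ring
  have e2 : ∑' y, q y * h y ^ 2 - m ^ 2
      = ∑' y, q y * h y ^ 2 - 2 * m * m + m ^ 2 * 1 := by ring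
  rw [e1, e2]
  exact this

theorem hr_markov {ι : Type} {P : ι → ι → ℝ} {p : ι → ℝ} (hP0 : ∀ x y, 0 ≤ P x y)
    (hP : ∀ x, HasSum (P x) 1) (hp0 : ∀ x, 0 < p x) (hp : HasSum p 1)
    (hst : ∀ y, HasSum (fun x => p x * P x y) (p y))
    (R : ℕ → ι → ι → Prop) (hR0 : ∀ x y, R 0 x y → x = y)
    (hR1 : ∀ n x y, R (n + 1) x y → ∃ z, R n x z ∧ P z y ≠ 0)
    (hirr : ∀ x y, ∃ n, R n x y)
    (haper : ∀ x, ∀ d : ℕ, (∀ n, 0 < n → R n x x → d ∣ n) → d = 1)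
    (g : ℕ → ι → ℝ) (g0 : ∀ n x, 0 ≤ g n x) (g1 : ∀ n x, g n x ≤ 1)
    (hg : ∀ n x, g (n + 1) x = ∑' y, P x y * g n y) (x : ι) :
    Tendsto (fun n => g n x) atTop (𝓝 (∑' y, p y * g 0 y)) := by
  rw [tendsto_iff_ultrafilter]
  intro U hU
  have hlim : ∀ k y, ∃ c ∈ Set.Icc (0:ℝ) 1, Tendsto (fun n => g (n + k) y) U (𝓝 c) := by
    intro k y
    obtain ⟨c, hc, h⟩ := (isCompact_Icc (a := (0:ℝ)) (b := 1)).ultrafilter_le_nhds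
      (U.map fun n => g (n + k) y) (by
        simp only [le_principal_iff, Ultrafilter.mem_coe, Ultrafilter.mem_map]
        exact Filter.univ_mem' fun n => ⟨g0 _ _, g1 _ _⟩)
    exact ⟨c, hc, h⟩
  choose G hG01 hG using hlim
  have G0 : ∀ k y, 0 ≤ G k y := fun k y => (hG01 k y).1
  have G1 : ∀ k y, G k y ≤ 1 := fun k y => (hG01 k y).2
  have DC : ∀ (q : ι → ℝ), (∀ y, 0 ≤ q y) → Summable q → ∀ k (e : ℕ),
      Tendsto (fun n => ∑' y, q y * g (n + k) y ^ e) U (𝓝 (∑' y, q y * G k y ^ e)) := by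
    intro q hq0 hq k e
    refine tendsto_tsum_of_dominated_convergence hq
      (fun y => ((hG k y).pow e).const_mul _) (Eventually.of_forall fun n y => ?_)
    rw [Real.norm_of_nonneg (mul_nonneg (hq0 y) (pow_nonneg (g0 _ _) _))]
    exact mul_le_of_le_one_right (hq0 y) (pow_le_one₀ (g0 _ _) (g1 _ _))
  have hGs : ∀ k y, G (k + 1) y = ∑' z, P y z * G k z := by
    intro k y
    have h1 := DC (P y) (hP0 y) (hP y).summable k 1
    simp only [pow_one, ← hg] at h1
    exact tendsto_nhds_unique (hG (k + 1) y) h1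
  have sq01 : ∀ h : ι → ℝ, (∀ x, 0 ≤ h x) → (∀ x, h x ≤ 1) → ∀ x, h x ^ 2 ≤ 1 :=
    fun h a b x => pow_le_one₀ (a x) (b x)
  set s : ℕ → ℝ := fun n => ∑' y, p y * g n y ^ 2 with hs
  have hanti : Antitone s := by
    refine antitone_nat_of_succ_le fun n => ?_
    simp only [hs]
    rw [← hr_stat hP0 hP hp0 hp hst (fun y => sq_nonneg (g n y)) (sq01 _ (g0 n) (g1 n))]
    refine Summable.tsum_le_tsum (fun y => ?_) ?_ ?_
    · refine mul_le_mul_of_nonneg_left ?_ (hp0 y).le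
      have := (hr_var (hP0 y) (hP y) (g0 n) (g1 n)).nonneg
        (fun z => mul_nonneg (hP0 y z) (sq_nonneg _))
      rw [hg]; linarith
    · exact hr_summable_aux (fun y => (hp0 y).le) hp.summable (fun y => sq_nonneg _)
        (sq01 _ (g0 _) (g1 _))
    · exact hr_summable_aux (fun y => (hp0 y).le) hp.summable
        (fun y => tsum_nonneg fun z => mul_nonneg (hP0 _ _) (sq_nonneg _))
        (fun y => hr_le_one_aux (hP0 y) (hP y) (fun y => sq_nonneg _) (sq01 _ (g0 _) (g1 _)))
  have hsl : ∃ c, Tendsto s atTop (𝓝 c) := by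
    refine ⟨_, tendsto_atTop_ciInf hanti ⟨0, ?_⟩⟩
    rintro _ ⟨n, rfl⟩
    exact tsum_nonneg fun y => mul_nonneg (hp0 y).le (sq_nonneg _)
  obtain ⟨c, hc⟩ := hsl
  have hGc : ∀ k, ∑' y, p y * G k y ^ 2 = c := fun k =>
    tendsto_nhds_unique (DC p (fun y => (hp0 y).le) hp.summable k 2)
      (((tendsto_add_atTop_iff_nat k).2 hc).mono_left hU)
  have hvar0 : ∀ k y, ∑' z, P y z * G k z ^ 2 - (∑' z, P y z * G k z) ^ 2 = 0 := by
    intro k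
    have e1 : HasSum (fun y => p y * ∑' z, P y z * G k z ^ 2) c := by
      rw [← hGc k, ← hr_stat hP0 hP hp0 hp hst (fun y => sq_nonneg (G k y))
        (sq01 _ (G0 k) (G1 k))]
      exact (hr_summable_aux (fun y => (hp0 y).le) hp.summable
        (fun y => tsum_nonneg fun z => mul_nonneg (hP0 _ _) (sq_nonneg _))
        (fun y => hr_le_one_aux (hP0 y) (hP y) (fun y => sq_nonneg _)
          (sq01 _ (G0 _) (G1 _)))).hasSum
    have e2 : HasSum (fun y => p y * G (k+1) y ^ 2) c := by
      rw [← hGc (k+1)]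
      exact (hr_summable_aux (fun y => (hp0 y).le) hp.summable (fun y => sq_nonneg _)
        (sq01 _ (G0 _) (G1 _))).hasSum
    have e3 := e1.sub e2
    rw [sub_self] at e3
    simp only [hGs k, ← mul_sub] at e3
    have e4 := (hasSum_zero_iff_of_nonneg (fun y => mul_nonneg (hp0 y).le
      ((hr_var (hP0 y) (hP y) (G0 k) (G1 k)).nonneg
        (fun z => mul_nonneg (hP0 y z) (sq_nonneg _))))).1 e3
    intro y
    have := congrFun e4 y
    simpa [(hp0 y).ne'] using this
  have step : ∀ k y z, P y z ≠ 0 → G k z = G (k+1) y := by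
    intro k y z hz
    have h := hr_var (hP0 y) (hP y) (G0 k) (G1 k)
    rw [hvar0] at h
    have e4 := congrFun ((hasSum_zero_iff_of_nonneg
      (fun z => mul_nonneg (hP0 y z) (sq_nonneg _))).1 h) z
    simp only [Pi.zero_apply, mul_eq_zero, hz, false_or, ← hGs] at e4
    exact sub_eq_zero.1 (pow_eq_zero_iff two_ne_zero |>.1 e4)
  have steps : ∀ n k y z, R n y z → G k z = G (k + n) y := by
    intro n
    induction n with
    | zero => intro k y z h; rw [hR0 _ _ h]; rfl
    | succ n ih =>
      intro k y z h
      obtain ⟨t, ht, hPt⟩ := hR1 _ _ _ h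
      rw [step k t z hPt, ih (k+1) y t ht]; congr 1; ring
  have per : ∀ k y, G (k+1) y = G k y := by
    intro k y
    let T : AddSubmonoid ℕ :=
      { carrier := {n | ∀ k, G (k + n) y = G k y}
        zero_mem' := fun k => rfl
        add_mem' := by
          intro a b ha hb k
          rw [← add_assoc, hb, ha] }
    let S : Set ℕ := {n | 0 < n ∧ R n y y}
    have hST : AddSubmonoid.closure S ≤ T :=
      (AddSubmonoid.closure_le).2 fun n hn k => (steps n k y y hn.2).symm
    have hgcd : Nat.setGcd S = 1 := haper y _ fun n hn hRn => Nat.setGcd_dvd_of_mem ⟨hn, hRn⟩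
    obtain ⟨N, hN⟩ := Nat.exists_mem_closure_of_ge S
    rw [hgcd] at hN
    have a := hST (hN N le_rfl (one_dvd _)) (k+1)
    have b := hST (hN (N+1) (Nat.le_succ _) (one_dvd _)) k
    rw [← a, ← b]; congr 1; ring
  have perk : ∀ k y, G k y = G 0 y := by
    intro k y
    induction k with
    | zero => rfl
    | succ k ih => rw [per, ih]
  have const : ∀ y, G 0 y = G 0 x := by
    intro y
    obtain ⟨n, hn⟩ := hirr x y
    rw [steps n 0 x y hn, perk]
  have hmean : ∀ n, ∑' y, p y * g n y = ∑' y, p y * g 0 y := by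
    intro n
    induction n with
    | zero => rfl
    | succ n ih =>
      rw [← ih, ← hr_stat hP0 hP hp0 hp hst (g0 n) (g1 n)]
      simp only [hg]
  have h1 := DC p (fun y => (hp0 y).le) hp.summable 0 1
  simp only [pow_one, hmean, const, tsum_mul_right, hp.tsum_eq, one_mul] at h1
  rw [tendsto_nhds_unique tendsto_const_nhds h1]
  exact hG 0 x

open scoped Topology

theorem hr_matPow_succ' {ι : Type} (A : ι → ι → ℝ≥0∞) (n : ℕ) (i j : ι) :
    matPow A (n + 1) i j = ∑' k, A i k * matPow A n k j := by
  induction n generalizing j with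
  | zero => 
    simp only [matPow]
    rw [tsum_eq_single i (fun k hk => by simp [Ne.symm hk]),
      tsum_eq_single j (fun k hk => by simp [hk])]
    simp
  | succ n ih =>
    rw [matPow]
    simp only [ih, ← ENNReal.tsum_mul_right]
    rw [ENNReal.tsum_comm]
    refine tsum_congr fun k => ?_
    rw [matPow, ← ENNReal.tsum_mul_left]
    simp only [mul_assoc]

theorem hr_matPow_eig {ι : Type} {A : ι → ι → ℝ≥0∞} {lam : ℝ≥0∞} {ξ : ι → ℝ≥0∞}
    (h : ∀ w, ∑' v, A w v * ξ v = lam * ξ w) (n : ℕ) (x : ι) :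
    ∑' y, matPow A n x y * ξ y = lam ^ n * ξ x := by
  induction n with
  | zero =>
    simp only [matPow]
    rw [tsum_eq_single x (fun k hk => by simp [Ne.symm hk])]
    simp
  | succ n ih =>
    simp only [matPow, ← ENNReal.tsum_mul_right]
    rw [ENNReal.tsum_comm]
    simp only [mul_assoc, ENNReal.tsum_mul_left, h]
    rw [pow_succ, mul_right_comm, ← ih, ← ENNReal.tsum_mul_right]
    refine tsum_congr fun k => ?_
    ring

theorem hr_hasSum_toReal {ι : Type} {f : ι → ℝ≥0∞} {a : ℝ≥0∞} (h : ∑' x, f x = a)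
    (ha : a ≠ ⊤) : HasSum (fun x => (f x).toReal) a.toReal := by
  rw [← h, ENNReal.tsum_toReal_eq (fun x => ENNReal.ne_top_of_tsum_ne_top (h ▸ ha) x)]
  exact (ENNReal.summable_toReal (h ▸ ha)).hasSum

theorem hr_height {ι : Type} {A : ι → ι → ℝ≥0∞}
    (lam : ℝ≥0∞) (hlam0 : lam ≠ 0) (hlamtop : lam ≠ ⊤)
    (hirr : MatIrreducible A) (haper : MatAperiodic A)
    (ξ η : ι → ℝ≥0∞)
    (hξpos : ∀ v, 0 < ξ v) (hξfin : ∀ v, ξ v ≠ ⊤)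
    (hηpos : ∀ v, 0 < η v) (hηfin : ∀ v, η v ≠ ⊤)
    (heigR : ∀ w, ∑' v, A w v * ξ v = lam * ξ w)
    (heigL : ∀ v, ∑' w, η w * A w v = lam * η v)
    (hnormξ : ∑' v, ξ v = 1)
    (hnormηξ : ∑' v, η v * ξ v = 1) (w : ι) :
    Tendsto (fun n : ℕ => (∑' u, matPow A n u w) / lam ^ n) atTop (𝓝 (η w)) := by
  have hξ0 : ∀ v, ξ v ≠ 0 := fun v => (hξpos v).ne'
  set P : ι → ι → ℝ≥0∞ := fun x y => A x y * ξ y * (lam⁻¹ * (ξ x)⁻¹) with hPdef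
  set g : ℕ → ι → ℝ≥0∞ := fun n x => matPow A n x w * ξ w * ((lam ^ n)⁻¹ * (ξ x)⁻¹) with hgdef
  have hPs : ∀ x, ∑' y, P x y = 1 := by
    intro x
    simp only [hPdef]
    rw [ENNReal.tsum_mul_right, heigR]
    rw [show lam * ξ x * (lam⁻¹ * (ξ x)⁻¹) = (lam * lam⁻¹) * (ξ x * (ξ x)⁻¹) by ring,
      ENNReal.mul_inv_cancel hlam0 hlamtop, ENNReal.mul_inv_cancel (hξ0 x) (hξfin x), one_mul]
  have hPfin : ∀ x y, P x y ≠ ⊤ := fun x y =>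
    ENNReal.ne_top_of_tsum_ne_top (by rw [hPs]; exact ENNReal.one_ne_top) y
  have hl0 : ∀ n, lam ^ n ≠ 0 := fun n => pow_ne_zero n hlam0
  have hlt : ∀ n, lam ^ n ≠ ⊤ := fun n => ENNReal.pow_ne_top hlamtop
  have hg1 : ∀ n x, g n x ≤ 1 := by
    intro n x
    calc g n x ≤ (lam ^ n * ξ x) * ((lam ^ n)⁻¹ * (ξ x)⁻¹) := by
          rw [← hr_matPow_eig heigR n x]
          simp only [hgdef]
          gcongr
          exact ENNReal.le_tsum (f := fun y => matPow A n x y * ξ y) w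
      _ = 1 := by
        rw [mul_mul_mul_comm, ENNReal.mul_inv_cancel (hl0 n) (hlt n),
          ENNReal.mul_inv_cancel (hξ0 x) (hξfin x), one_mul]
  have hgfin : ∀ n x, g n x ≠ ⊤ := fun n x => ((hg1 n x).trans_lt ENNReal.one_lt_top).ne
  have hgs : ∀ n x, ∑' y, P x y * g n y = g (n + 1) x := by
    intro n x
    simp only [hgdef, hPdef]
    rw [hr_matPow_succ', mul_assoc, ← ENNReal.tsum_mul_right]
    refine tsum_congr fun y => ?_
    rw [show A x y * ξ y * (lam⁻¹ * (ξ x)⁻¹) * (matPow A n y w * ξ w * ((lam ^ n)⁻¹ * (ξ y)⁻¹))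
      = A x y * matPow A n y w * (ξ w * ((lam⁻¹ * (lam ^ n)⁻¹) * (ξ x)⁻¹)) * (ξ y * (ξ y)⁻¹) by ring,
      ENNReal.mul_inv_cancel (hξ0 y) (hξfin y), mul_one, pow_succ',
      ENNReal.mul_inv (Or.inl hlam0) (Or.inl hlamtop)]
  have hst : ∀ y, ∑' x, η x * ξ x * P x y = η y * ξ y := by
    intro y
    have : ∀ x, η x * ξ x * P x y = η x * A x y * (lam⁻¹ * ξ y) := by
      intro x
      simp only [hPdef]
      rw [show η x * ξ x * (A x y * ξ y * (lam⁻¹ * (ξ x)⁻¹))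
        = η x * A x y * (lam⁻¹ * ξ y) * (ξ x * (ξ x)⁻¹) by ring,
        ENNReal.mul_inv_cancel (hξ0 x) (hξfin x), mul_one]
    simp only [this]
    rw [ENNReal.tsum_mul_right, heigL, show lam * η y * (lam⁻¹ * ξ y) = lam * lam⁻¹ * (η y * ξ y) by ring,
      ENNReal.mul_inv_cancel hlam0 hlamtop, one_mul]
  have hpfin : ∀ x, η x * ξ x ≠ ⊤ := fun x => ENNReal.mul_ne_top (hηfin x) (hξfin x)
  have hg0 : ∑' y, (η y * ξ y).toReal * (g 0 y).toReal = (η w * ξ w).toReal := by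
    rw [tsum_eq_single w]
    · simp [hgdef, matPow, ENNReal.mul_inv_cancel (hξ0 w) (hξfin w)]
    · intro y hy
      simp [hgdef, matPow, hy]
  have key : ∀ x, Tendsto (fun n => (g n x).toReal) atTop (𝓝 (η w * ξ w).toReal) := by
    intro x
    rw [← hg0]
    refine hr_markov (P := fun x y => (P x y).toReal) (p := fun y => (η y * ξ y).toReal)
      (fun _ _ => ENNReal.toReal_nonneg)
      (fun x => by simpa using hr_hasSum_toReal (hPs x) ENNReal.one_ne_top)
      (fun y => ENNReal.toReal_pos (mul_ne_zero (hηpos y).ne' (hξ0 y)) (hpfin y))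
      (by simpa using hr_hasSum_toReal hnormηξ ENNReal.one_ne_top)
      (fun y => by
        have := hr_hasSum_toReal (hst y) (hpfin y)
        simpa only [ENNReal.toReal_mul] using this)
      (fun n x y => matPow A n x y ≠ 0) ?_ ?_ ?_ ?_
      (fun n x => (g n x).toReal) (fun _ _ => ENNReal.toReal_nonneg) ?_ ?_ x
    · intro x y h
      by_contra hxy
      simp [matPow, hxy] at h
    · intro n x y h
      simp only [matPow, ne_eq, ENNReal.tsum_eq_zero, not_forall, mul_eq_zero, not_or] at h
      obtain ⟨z, h1, h2⟩ := h
      refine ⟨z, h1, ?_⟩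
      rw [ENNReal.toReal_ne_zero]
      refine ⟨?_, hPfin z y⟩
      simp only [hPdef]
      exact mul_ne_zero (mul_ne_zero h2 (hξ0 y)) (mul_ne_zero (ENNReal.inv_ne_zero.2 hlamtop)
        (ENNReal.inv_ne_zero.2 (hξfin z)))
    · intro x y
      obtain ⟨n, -, hn⟩ := hirr x y
      exact ⟨n, hn⟩
    · exact haper
    · intro n x
      exact ENNReal.toReal_le_of_le_ofReal zero_le_one (by simpa using hg1 n x)
    · intro n x
      have := (hr_hasSum_toReal (hgs n x) (hgfin _ _)).tsum_eq
      simpa only [ENNReal.toReal_mul] using this.symm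
  have hξs := hr_hasSum_toReal hnormξ ENNReal.one_ne_top
  have lim1 : Tendsto (fun n => ∑' u, (ξ u).toReal * (g n u).toReal) atTop
      (𝓝 (∑' u, (ξ u).toReal * (η w * ξ w).toReal)) := by
    refine tendsto_tsum_of_dominated_convergence hξs.summable
      (fun y => (key y).const_mul _) (Eventually.of_forall fun n y => ?_)
    rw [Real.norm_of_nonneg (mul_nonneg ENNReal.toReal_nonneg ENNReal.toReal_nonneg)]
    exact mul_le_of_le_one_right ENNReal.toReal_nonneg
      (ENNReal.toReal_le_of_le_ofReal zero_le_one (by simpa using hg1 n y))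
  rw [tsum_mul_right, hξs.tsum_eq, ENNReal.toReal_one, one_mul] at lim1
  have hle : ∀ n, ∑' u, ξ u * g n u ≠ ⊤ := by
    intro n
    refine ne_top_of_le_ne_top ENNReal.one_ne_top ?_
    rw [← hnormξ]
    exact ENNReal.tsum_le_tsum fun u => mul_le_of_le_one_right' (hg1 n u)
  have lim2 : Tendsto (fun n => ∑' u, ξ u * g n u) atTop (𝓝 (η w * ξ w)) := by
    rw [← ENNReal.tendsto_toReal_iff hle (hpfin w)]
    refine lim1.congr fun n => ?_
    have := (hr_hasSum_toReal (rfl : ∑' u, ξ u * g n u = _) (hle n)).tsum_eq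
    simpa only [ENNReal.toReal_mul] using this
  have lim3 := ENNReal.Tendsto.mul_const (b := (ξ w)⁻¹) lim2
    (Or.inr (ENNReal.inv_ne_top.2 (hξ0 w)))
  rw [mul_assoc, ENNReal.mul_inv_cancel (hξ0 w) (hξfin w), mul_one] at lim3
  refine lim3.congr fun n => ?_
  rw [← ENNReal.tsum_mul_right, div_eq_mul_inv, ← ENNReal.tsum_mul_right]
  refine tsum_congr fun u => ?_
  simp only [hgdef]
  rw [show ξ u * (matPow A n u w * ξ w * ((lam ^ n)⁻¹ * (ξ u)⁻¹)) * (ξ w)⁻¹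
    = matPow A n u w * (lam ^ n)⁻¹ * (ξ u * (ξ u)⁻¹) * (ξ w * (ξ w)⁻¹) by ring,
    ENNReal.mul_inv_cancel (hξ0 w) (hξfin w), ENNReal.mul_inv_cancel (hξ0 u) (hξfin u),
    mul_one, mul_one]

/-- Let `B(F)` be a stationary generalized Bratteli diagram with
`A = Fᵀ` irreducible, aperiodic and positive recurrent, with finite Perron eigenvalue
`lam` and right and left Perron eigenvectors `ξ`, `η` normalized so that `∑_v ξ_v = 1`
and `∑_v η_v ξ_v = 1`. Then for all vertices `v, w`, the ratio of tower heights
`H^{(n)}_w / H^{(n+1)}_v` converges to `η_w / (lam · η_v)` as `n → ∞`, where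
`H^{(n)}_u = ∑_{u₀} (Aⁿ)_{u₀ u}` is the number of finite paths from level `V_0` to the
vertex `u` of level `V_n`. -/
theorem heights_ratio_tendsto (B : StatGBD)
    (lam : ℝ≥0∞) (hlam0 : lam ≠ 0) (hlamtop : lam ≠ ⊤)
    (hirr : MatIrreducible B.Amat) (haper : MatAperiodic B.Amat)
    (hPerron : IsPerronValue B.Amat lam) (hrec : MatPosRecurrent B.Amat lam)
    (ξ η : ℤ → ℝ≥0∞)
    (hξpos : ∀ v, 0 < ξ v) (hξfin : ∀ v, ξ v ≠ ⊤)
    (hηpos : ∀ v, 0 < η v) (hηfin : ∀ v, η v ≠ ⊤)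
    (heigR : ∀ w : ℤ, ∑' v : ℤ, B.Amat w v * ξ v = lam * ξ w)
    (heigL : ∀ v : ℤ, ∑' w : ℤ, η w * B.Amat w v = lam * η v)
    (hnormξ : ∑' v : ℤ, ξ v = 1)
    (hnormηξ : ∑' v : ℤ, η v * ξ v = 1)
    (v w : ℤ) :
    Filter.Tendsto
      (fun n : ℕ => (∑' u : ℤ, matPow B.Amat n u w) / (∑' u : ℤ, matPow B.Amat (n + 1) u v))
      Filter.atTop (nhds (η w / (lam * η v))) := by
  have hl0 : ∀ n, lam ^ n ≠ 0 := fun n => pow_ne_zero n hlam0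
  have hlt : ∀ n, lam ^ n ≠ ⊤ := fun n => ENNReal.pow_ne_top hlamtop
  have h1 := hr_height lam hlam0 hlamtop hirr haper ξ η hξpos hξfin hηpos hηfin heigR heigL
    hnormξ hnormηξ w
  have h2 := (tendsto_add_atTop_iff_nat 1).2 (hr_height lam hlam0 hlamtop hirr haper ξ η hξpos
    hξfin hηpos hηfin heigR heigL hnormξ hnormηξ v)
  have h3 := ENNReal.Tendsto.const_mul (a := lam) h2 (Or.inr hlamtop)
  have h4 := ENNReal.Tendsto.div h1 (Or.inl (hηpos w).ne') h3
    (Or.inl (ENNReal.mul_ne_top hlamtop (hηfin v)))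
  refine h4.congr fun n => ?_
  rw [pow_succ' lam n, mul_div_assoc', ENNReal.mul_div_mul_left _ _ hlam0 hlamtop,
    ENNReal.div_eq_inv_mul, ENNReal.div_eq_inv_mul (b := lam ^ n), ENNReal.div_eq_inv_mul (b := lam ^ n)]
  rw [← ENNReal.div_eq_inv_mul, ENNReal.mul_div_mul_left _ _ (ENNReal.inv_ne_zero.2 (hlt n))
    (ENNReal.inv_ne_top.2 (hl0 n))]
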